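/- Let a > 0 be real and let δ, d be integers with 2 ≤ δ and 2δ < d. For k ∈ {1,…,d} let ω_k := exp(2πi(k−1)/d) and define J_k := Σ_{l=1}^{δ} M'_l · ω_k^{l−1} ∈ ℂ^{(2δ−1)×(2δ−1)}, where the blocks M'_l are built from the masks m_l as described below. Then for all i, j ∈ {1,…,2δ−1}, (J_k)_{i,j} = (2δ−1)^{−1/2}·exp(−2πi(i−1)(j−1)/(2δ−1))·s_{k,j}; equivalently, J_k = F_{2δ−1}·diag(s_{k,1},…,s_{k,2δ−1}), where F_{2δ−1} is the unitary DFT matrix with entries (F_{2δ−1})_{i,j} = (2δ−1)^{−1/2}·exp(−2πi(i−1)(j−1)/(2δ−1)). -/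

import Mathlib

/-- The local correlation masks: `(m_l)_i = e^{−i/a}·(2δ−1)^{−1/4}·exp(2πi(i−1)(l−1)/(2δ−1))`
for `1 ≤ i ≤ δ` and `0` for `i > δ` (1-based indices). `mask a δ l i` is `(m_l)_i`. -/
noncomputable def mask (a : ℝ) (δ : ℕ) (l i : ℕ) : ℂ :=
  if i ≤ δ then
    ((Real.exp (-(i : ℝ) / a) * (2 * (δ : ℝ) - 1) ^ (-(1 / 4 : ℝ)) : ℝ) : ℂ)
      * Complex.exp (2 * Real.pi * Complex.I * ((i : ℂ) - 1) * ((l : ℂ) - 1)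
          / (2 * (δ : ℂ) - 1))
  else 0

/-- The blocks `M'_l ∈ ℂ^{(2δ−1)×(2δ−1)}`, `1 ≤ l ≤ δ` (all indices 1-based):
`blk a δ l i j = (M'_l)_{i,j}`. -/
noncomputable def blk (a : ℝ) (δ : ℕ) (l i j : ℕ) : ℂ :=
  if j ≤ δ - l + 1 then mask a δ i l * (starRingEnd ℂ) (mask a δ i (j + l - 1))
  else if j ≤ 2 * δ - l - 1 then 0
  else if l < δ then mask a δ i (l + 1) * (starRingEnd ℂ) (mask a δ i (l + j - 2 * δ + 1))
  else 0

/-- The diagonal entries `s_{k,j}` (1-based indices `k ∈ {1,…,d}`, `j ∈ {1,…,2δ−1}`),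
where `ω_k = exp(2πi(k−1)/d)`. -/
noncomputable def sval (a : ℝ) (d δ k j : ℕ) : ℂ :=
  let ω : ℂ := Complex.exp (2 * Real.pi * Complex.I * ((k : ℂ) - 1) / (d : ℂ))
  if j ≤ δ then
    (Real.exp (-((j : ℝ) + 1) / a) : ℂ)
      * (1 - (Real.exp (-2 * ((δ : ℝ) - (j : ℝ) + 1) / a) : ℂ) * ω ^ (δ - j + 1))
      / (1 - (Real.exp (-2 / a) : ℂ) * ω)
  else
    (Real.exp (-(2 * ((δ : ℝ) + 1) - (j : ℝ)) / a) : ℂ) * ω ^ (2 * δ - j - 1)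
      * (1 - (Real.exp (-2 * ((j : ℝ) - (δ : ℝ)) / a) : ℂ) * ω ^ (j - δ))
      / (1 - (Real.exp (-2 / a) : ℂ) * ω)

/-- The product of two entries of one mask depends on the phases only through the difference of
the positions. -/
theorem mask_mul_conj_mask (a : ℝ) {δ : ℕ} (hδ : 1 ≤ δ) (l : ℕ) {p q : ℕ}
    (hp : p ≤ δ) (hq : q ≤ δ) :
    mask a δ l p * (starRingEnd ℂ) (mask a δ l q)
      = (((2 * (δ : ℝ) - 1) ^ (-(1 / 2 : ℝ)) : ℝ) : ℂ)
        * Complex.exp (2 * Real.pi * Complex.I * ((p : ℂ) - q) * ((l : ℂ) - 1)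
            / (2 * (δ : ℂ) - 1))
        * (Real.exp (-((p : ℝ) + q) / a) : ℂ) := by
  have hN : (0 : ℝ) < 2 * (δ : ℝ) - 1 := by
    have : (1 : ℝ) ≤ δ := by exact_mod_cast hδ
    linarith
  have hexp : Real.exp (-((p : ℝ) + q) / a)
      = Real.exp (-(p : ℝ) / a) * Real.exp (-(q : ℝ) / a) := by
    rw [← Real.exp_add]; ring_nf
  have hpow : (2 * (δ : ℝ) - 1) ^ (-(1 / 2 : ℝ))
      = (2 * (δ : ℝ) - 1) ^ (-(1 / 4 : ℝ)) * (2 * (δ : ℝ) - 1) ^ (-(1 / 4 : ℝ)) := by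
    rw [← Real.rpow_add hN]; norm_num
  have hphase : Complex.exp (2 * Real.pi * Complex.I * ((p : ℂ) - q) * ((l : ℂ) - 1)
        / (2 * (δ : ℂ) - 1))
      = Complex.exp (2 * Real.pi * Complex.I * ((p : ℂ) - 1) * ((l : ℂ) - 1)
          / (2 * (δ : ℂ) - 1))
        * (starRingEnd ℂ) (Complex.exp (2 * Real.pi * Complex.I * ((q : ℂ) - 1)
          * ((l : ℂ) - 1) / (2 * (δ : ℂ) - 1))) := by
    rw [← Complex.exp_conj, ← Complex.exp_add]
    simp only [map_div₀, map_mul, map_sub, Complex.conj_ofReal, Complex.conj_I, map_natCast,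
      map_one, map_ofNat]
    ring_nf
  rw [mask, mask, if_pos hp, if_pos hq, hexp, hpow, hphase, map_mul, Complex.conj_ofReal]
  push_cast
  ring

/-- Geometric sum for a ratio of modulus less than one, written as a real decay times a phase. -/
theorem sum_exp_mul_pow {a : ℝ} (ha : 0 < a) {ω : ℂ} (hω : ‖ω‖ = 1) (n : ℕ) :
    ∑ t ∈ Finset.range n, (Real.exp (-2 * (t : ℝ) / a) : ℂ) * ω ^ t
      = (1 - (Real.exp (-2 * (n : ℝ) / a) : ℂ) * ω ^ n)
        / (1 - (Real.exp (-2 / a) : ℂ) * ω) := by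
  have hpow (t : ℕ) : (Real.exp (-2 * (t : ℝ) / a) : ℂ) * ω ^ t
      = ((Real.exp (-2 / a) : ℂ) * ω) ^ t := by
    rw [mul_pow, ← Complex.ofReal_pow, ← Real.exp_nat_mul]
    ring_nf
  have hne : (Real.exp (-2 / a) : ℂ) * ω ≠ 1 := by
    intro h
    have h1 := congrArg norm h
    rw [norm_mul, hω, mul_one, Complex.norm_real, Real.norm_eq_abs, Real.abs_exp, norm_one,
      Real.exp_eq_one_iff] at h1
    exact absurd h1 (div_neg_of_neg_of_pos (by norm_num) ha).ne
  simp_rw [hpow]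
  rw [geom_sum_eq hne, ← neg_div_neg_eq, neg_sub, neg_sub]

/-- For `a > 0`, integers `2 ≤ δ`, `2δ < d`, `k ∈ {1,…,d}`, the matrix
`J_k = Σ_{l=1}^{δ} M'_l · ω_k^{l−1}` satisfies, for all `i, j ∈ {1,…,2δ−1}`,
`(J_k)_{i,j} = (2δ−1)^{−1/2}·exp(−2πi(i−1)(j−1)/(2δ−1))·s_{k,j}`;
i.e. `J_k = F_{2δ−1}·diag(s_{k,1},…,s_{k,2δ−1})` entrywise. -/
theorem stmt_13 (a : ℝ) (ha : 0 < a) (δ d : ℕ) (hδ : 2 ≤ δ) (hd : 2 * δ < d)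
    (k : ℕ) (hk1 : 1 ≤ k) (hkd : k ≤ d)
    (i j : ℕ) (hi1 : 1 ≤ i) (hi2 : i ≤ 2 * δ - 1) (hj1 : 1 ≤ j) (hj2 : j ≤ 2 * δ - 1) :
    ∑ l ∈ Finset.Icc 1 δ,
        blk a δ l i j
          * Complex.exp (2 * Real.pi * Complex.I * ((k : ℂ) - 1) / (d : ℂ)) ^ (l - 1)
      = (((2 * (δ : ℝ) - 1) ^ (-(1 / 2 : ℝ)) : ℝ) : ℂ)
          * Complex.exp (-(2 * Real.pi * Complex.I * ((i : ℂ) - 1) * ((j : ℂ) - 1))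
              / (2 * (δ : ℂ) - 1))
          * sval a d δ k j := by
  have hω : ‖Complex.exp (2 * Real.pi * Complex.I * ((k : ℂ) - 1) / (d : ℂ))‖ = 1 := by
    rw [show 2 * Real.pi * Complex.I * ((k : ℂ) - 1) / (d : ℂ)
      = ((2 * Real.pi * ((k : ℝ) - 1) / d : ℝ) : ℂ) * Complex.I by push_cast; ring]
    exact Complex.norm_exp_ofReal_mul_I _
  simp only [sval]
  generalize Complex.exp (2 * Real.pi * Complex.I * ((k : ℂ) - 1) / (d : ℂ)) = ω at hω ⊢
  by_cases hj : j ≤ δ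
  · have hsub : Finset.Ico 1 (δ - j + 2) ⊆ Finset.Icc 1 δ := by
      intro l; simp only [Finset.mem_Ico, Finset.mem_Icc]; omega
    have hcast : (δ : ℝ) - j + 1 = ((δ - j + 1 : ℕ) : ℝ) := by
      push_cast [Nat.cast_sub hj]; ring
    rw [if_pos hj, hcast, mul_div_assoc, ← sum_exp_mul_pow ha hω, ← Finset.sum_subset hsub,
      Finset.sum_Ico_eq_sum_range, show δ - j + 2 - 1 = δ - j + 1 by omega, Finset.mul_sum,
      Finset.mul_sum]
    · refine Finset.sum_congr rfl fun t ht => ?_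
      rw [Finset.mem_range] at ht
      have hexp : Real.exp (-(((1 + t : ℕ) : ℝ) + (j + t : ℕ)) / a)
          = Real.exp (-((j : ℝ) + 1) / a) * Real.exp (-2 * (t : ℝ) / a) := by
        rw [← Real.exp_add]; push_cast; ring_nf
      have hphase : 2 * Real.pi * Complex.I * (((1 + t : ℕ) : ℂ) - (j + t : ℕ)) * ((i : ℂ) - 1)
            / (2 * (δ : ℂ) - 1)
          = -(2 * Real.pi * Complex.I * ((i : ℂ) - 1) * ((j : ℂ) - 1)) / (2 * (δ : ℂ) - 1) := by
        push_cast; ring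
      rw [blk, if_pos (by omega), show j + (1 + t) - 1 = j + t by omega,
        mask_mul_conj_mask a (by omega) i (by omega) (by omega), hexp, hphase,
        Nat.add_sub_cancel_left]
      push_cast
      ring
    · intro l hl hl'
      simp only [Finset.mem_Icc, Finset.mem_Ico] at hl hl'
      have hblk : blk a δ l i j = 0 := by
        rw [blk, if_neg (by omega)]
        split_ifs <;> first | rfl | omega
      rw [hblk, zero_mul]
  · have hsub : Finset.Ico (2 * δ - j) δ ⊆ Finset.Icc 1 δ := by
      intro l; simp only [Finset.mem_Ico, Finset.mem_Icc]; omega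
    have hcast : (j : ℝ) - δ = ((j - δ : ℕ) : ℝ) := by
      push_cast [Nat.cast_sub (not_le.mp hj).le]; ring
    rw [if_neg hj, hcast, mul_div_assoc, ← sum_exp_mul_pow ha hω, ← Finset.sum_subset hsub,
      Finset.sum_Ico_eq_sum_range, show δ - (2 * δ - j) = j - δ by omega, Finset.mul_sum,
      Finset.mul_sum]
    · refine Finset.sum_congr rfl fun t ht => ?_
      rw [Finset.mem_range] at ht
      have hN : 2 * (δ : ℂ) - 1 ≠ 0 := by
        rw [sub_ne_zero]; norm_cast; omega
      have hle : j ≤ 2 * δ := by omega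
      have hexp : Real.exp (-(((2 * δ - j + t + 1 : ℕ) : ℝ) + (t + 1 : ℕ)) / a)
          = Real.exp (-(2 * ((δ : ℝ) + 1) - (j : ℝ)) / a) * Real.exp (-2 * (t : ℝ) / a) := by
        rw [← Real.exp_add]; push_cast [Nat.cast_sub hle]; ring_nf
      have hphase : Complex.exp (2 * Real.pi * Complex.I
            * (((2 * δ - j + t + 1 : ℕ) : ℂ) - (t + 1 : ℕ)) * ((i : ℂ) - 1) / (2 * (δ : ℂ) - 1))
          = Complex.exp (-(2 * Real.pi * Complex.I * ((i : ℂ) - 1) * ((j : ℂ) - 1))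
            / (2 * (δ : ℂ) - 1)) := by
        rw [Complex.exp_eq_exp_iff_exists_int]
        refine ⟨(i : ℤ) - 1, ?_⟩
        push_cast [Nat.cast_sub hle]
        field_simp
        ring
      rw [blk, if_neg (by omega), if_neg (by omega), if_pos (by omega),
        show 2 * δ - j + t + j - 2 * δ + 1 = t + 1 by omega,
        mask_mul_conj_mask a (by omega) i (by omega) (by omega), hexp, hphase,
        show 2 * δ - j + t - 1 = 2 * δ - j - 1 + t by omega, pow_add]
      push_cast
      ring
    · intro l hl hl'
      simp only [Finset.mem_Icc, Finset.mem_Ico] at hl hl'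
      have hblk : blk a δ l i j = 0 := by
        rw [blk, if_neg (by omega)]
        split_ifs <;> first | rfl | omega
      rw [hblk, zero_mul]
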